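/- Let (X, d) be a complete separable metric space with finite Borel measure m. The set of Borel functions G ∈ Lᵖ(m), G ≥ 0, satisfying ∫ |f(γ₁) − f(γ₀)| dπ(γ) ≤ ∫∫₀¹ G(γ_t)|γ̇_t| dt dπ(γ) for every q-test plan π, is a convex and closed subset of Lᵖ(m); in particular, if nonempty it contains an element of minimal Lᵖ-norm. -/

import Mathlib

open MeasureTheory unitInterval
open scoped ENNReal NNReal

noncomputable instance {X : Type*} [MetricSpace X] : MeasurableSpace C(unitInterval, X) :=
  borel _

variable {X : Type*} [MetricSpace X] [CompleteSpace X] [TopologicalSpace.SeparableSpace X]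
  [MeasurableSpace X] [BorelSpace X]

/-- The (upper) metric derivative `|γ̇_t|` of a curve. -/
noncomputable def metricSpeed (γ : C(unitInterval, X)) (t : unitInterval) : ℝ≥0∞ :=
  Filter.limsup
    (fun s : unitInterval => ENNReal.ofReal (dist (γ s) (γ t)) / ENNReal.ofReal (dist s t))
    (nhdsWithin t {t}ᶜ)

/-- A curve is absolutely continuous if `d(γ_s, γ_t) ≤ ∫_s^t g` for some integrable `g`. -/
def IsACCurve (γ : C(unitInterval, X)) : Prop :=
  ∃ g : unitInterval → ℝ≥0∞, (∫⁻ t, g t) < ⊤ ∧ ∀ s t : unitInterval, s ≤ t →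
    ENNReal.ofReal (dist (γ s) (γ t)) ≤ ∫⁻ r in Set.Icc s t, g r

/-- A `q`-test plan: a probability measure on `C([0,1]; X)` concentrated on absolutely
continuous curves, with bounded compression and finite `q`-kinetic energy. -/
def IsTestPlan (m : Measure X) (q : ℝ) (π : Measure C(unitInterval, X)) : Prop :=
  IsProbabilityMeasure π ∧ (∀ᵐ γ ∂π, IsACCurve γ) ∧
  (∃ C : ℝ≥0, 0 < C ∧ ∀ t : unitInterval,
      Measure.map (fun γ : C(unitInterval, X) => γ t) π ≤ (C : ℝ≥0∞) • m) ∧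
  ∫⁻ γ, ∫⁻ t, metricSpeed γ t ^ q ∂volume ∂π < ⊤

/-- The set of nonnegative `G ∈ Lᵖ(m)` satisfying the weak upper gradient inequality
for `f` along every `q`-test plan. -/
def gradSet (m : Measure X) (p : ℝ≥0∞) (q : ℝ) (f : X → ℝ) : Set (Lp ℝ p m) :=
  {G | 0 ≤ᵐ[m] (G : X → ℝ) ∧ ∀ π : Measure C(unitInterval, X), IsTestPlan m q π →
    ∫⁻ γ, ENNReal.ofReal |f (γ 1) - f (γ 0)| ∂π ≤
      ∫⁻ γ, ∫⁻ t, ENNReal.ofReal ((G : X → ℝ) (γ t)) * metricSpeed γ t ∂volume ∂π}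

/-- On the unit segment `x + y = 1` of the positive quadrant, a strictly convex power controls the
`p`-th power of `|x - y|` up to an arbitrarily small error. -/
lemma exists_abs_sub_rpow_le_unit {p : ℝ} (hp : 1 < p) {ε : ℝ} (hε : 0 < ε) :
    ∃ K : ℝ, 0 ≤ K ∧ ∀ u ∈ Set.Icc (0 : ℝ) 1,
      |u - (1 - u)| ^ p ≤ ε + K * ((u ^ p + (1 - u) ^ p) / 2 - ((u + (1 - u)) / 2) ^ p) := by
  have hp0 : 0 < p := by linarith
  let h : ℝ → ℝ := fun u => (u ^ p + (1 - u) ^ p) / 2 - ((u + (1 - u)) / 2) ^ p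
  have hstrict := strictConvexOn_rpow hp
  have h_pos : ∀ u ∈ Set.Icc (0 : ℝ) 1, u ≠ 1 - u → 0 < h u := by
    intro u hu hne
    have := hstrict.2 (show u ∈ Set.Ici (0 : ℝ) from hu.1)
      (show 1 - u ∈ Set.Ici (0 : ℝ) from sub_nonneg.2 hu.2) hne
      (show (0 : ℝ) < 1 / 2 by norm_num) (show (0 : ℝ) < 1 / 2 by norm_num) (by norm_num)
    simp only [smul_eq_mul] at this
    have e : (1 / 2 * u + 1 / 2 * (1 - u) : ℝ) = (u + (1 - u)) / 2 := by ring
    rw [e] at this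
    simp only [h]
    linarith
  have h_nonneg : ∀ u ∈ Set.Icc (0 : ℝ) 1, 0 ≤ h u := by
    intro u hu
    by_cases hne : u = 1 - u
    · simp only [h, ← hne]
      rw [add_self_div_two, add_self_div_two, sub_self]
    · exact (h_pos u hu hne).le
  have hcont : Continuous h := by
    have h1 : Continuous fun u : ℝ => u ^ p := Real.continuous_rpow_const hp0.le
    exact ((h1.add (h1.comp (continuous_const.sub continuous_id))).div_const 2).sub
      (h1.comp ((continuous_id.add (continuous_const.sub continuous_id)).div_const 2))
  have hcont' : Continuous fun u : ℝ => |u - (1 - u)| ^ p :=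
    (Real.continuous_rpow_const hp0.le).comp (by fun_prop)
  have hS : IsCompact (Set.Icc (0 : ℝ) 1 ∩ {u | ε ≤ |u - (1 - u)| ^ p}) :=
    isCompact_Icc.inter_right (isClosed_le continuous_const hcont')
  have h_le_one : ∀ u ∈ Set.Icc (0 : ℝ) 1, |u - (1 - u)| ^ p ≤ 1 := fun u hu =>
    Real.rpow_le_one (abs_nonneg _) (abs_le.2 ⟨by linarith [hu.1], by linarith [hu.2]⟩) hp0.le
  rcases (Set.Icc (0 : ℝ) 1 ∩ {u | ε ≤ |u - (1 - u)| ^ p}).eq_empty_or_nonempty with hemp | hne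
  · refine ⟨0, le_rfl, fun u hu => ?_⟩
    by_contra! hlt
    have : u ∈ (∅ : Set ℝ) := hemp ▸ ⟨hu, by simpa using hlt.le⟩
    exact this
  · obtain ⟨v, hv, hmin⟩ := hS.exists_isMinOn hne hcont.continuousOn
    have hv_pos : 0 < h v := by
      refine h_pos v hv.1 fun hvv => ?_
      have : ε ≤ |v - (1 - v)| ^ p := hv.2
      rw [← hvv, sub_self, abs_zero, Real.zero_rpow hp0.ne'] at this
      linarith
    refine ⟨(h v)⁻¹, (inv_pos.2 hv_pos).le, fun u hu => ?_⟩
    change _ ≤ ε + (h v)⁻¹ * h u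
    by_cases hu' : ε ≤ |u - (1 - u)| ^ p
    · have : h v ≤ h u := hmin ⟨hu, hu'⟩
      have : 1 ≤ (h v)⁻¹ * h u := by
        rw [inv_mul_eq_div]
        exact (one_le_div hv_pos).2 this
      linarith [h_le_one u hu]
    · have := mul_nonneg (inv_pos.2 hv_pos).le (h_nonneg u hu)
      linarith

/-- Quantitative strict convexity of `x ↦ x ^ p` on the half line. -/
lemma exists_abs_sub_rpow_le {p : ℝ} (hp : 1 < p) {ε : ℝ} (hε : 0 < ε) :
    ∃ K : ℝ, 0 ≤ K ∧ ∀ x y : ℝ, 0 ≤ x → 0 ≤ y →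
      |x - y| ^ p ≤ ε * (x + y) ^ p + K * ((x ^ p + y ^ p) / 2 - ((x + y) / 2) ^ p) := by
  obtain ⟨K, hK, hle⟩ := exists_abs_sub_rpow_le_unit hp hε
  refine ⟨K, hK, fun x y hx hy => ?_⟩
  have hp0 : p ≠ 0 := by linarith
  rcases (add_nonneg hx hy).eq_or_lt with h0 | hs
  · obtain rfl : x = 0 := by linarith
    obtain rfl : y = 0 := by linarith
    simp [Real.zero_rpow hp0]
  · set s := x + y with hs_def
    have hu : x / s ∈ Set.Icc (0 : ℝ) 1 :=
      ⟨by positivity, (div_le_one hs).2 (by linarith)⟩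
    have e1 : 1 - x / s = y / s := by
      rw [eq_div_iff hs.ne', sub_mul, div_mul_cancel₀ _ hs.ne', one_mul, hs_def, add_sub_cancel_left]
    have key := mul_le_mul_of_nonneg_right (hle _ hu) (Real.rpow_nonneg hs.le p)
    rw [e1] at key
    have scale : ∀ a : ℝ, 0 ≤ a → (a / s) ^ p * s ^ p = a ^ p := fun a ha => by
      rw [← Real.mul_rpow (by positivity) hs.le, div_mul_cancel₀ _ hs.ne']
    have e2 : |x / s - y / s| = |x - y| / s := by
      rw [← sub_div, abs_div, abs_of_pos hs]
    have e3 : (x / s + y / s) / 2 = (s / 2) / s := by rw [← add_div]; ring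
    rw [e2, e3, scale _ (abs_nonneg _)] at key
    calc |x - y| ^ p ≤ _ := key
      _ = ε * s ^ p + K * (((x / s) ^ p * s ^ p + (y / s) ^ p * s ^ p) / 2
            - (s / 2 / s) ^ p * s ^ p) := by ring
      _ = _ := by rw [scale x hx, scale y hy, scale (s / 2) (by positivity)]

section LpNorm

variable {Y : Type*} [MeasurableSpace Y] {μ : Measure Y} {p : ℝ≥0∞}

lemma Lp_norm_rpow_eq_integral (hp : 1 < p) (hp' : p ≠ ⊤) (G : Lp ℝ p μ) :
    ‖G‖ ^ p.toReal = ∫ x, |G x| ^ p.toReal ∂μ := by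
  have hp0 : p ≠ 0 := (zero_lt_one.trans hp).ne'
  have hP : 0 < p.toReal := ENNReal.toReal_pos hp0 hp'
  have hnn : 0 ≤ ∫ x, ‖G x‖ ^ p.toReal ∂μ := integral_nonneg fun x => by positivity
  rw [Lp.norm_def, (Lp.memLp G).eLpNorm_eq_integral_rpow_norm hp0 hp',
    ENNReal.toReal_ofReal (by positivity), ← Real.rpow_mul hnn, inv_mul_cancel₀ hP.ne',
    Real.rpow_one]
  simp only [Real.norm_eq_abs]

/-- Quantitative uniform convexity of `Lᵖ` on the cone of nonnegative functions. -/
lemma exists_Lp_norm_sub_rpow_le (hp : 1 < p) [Fact (1 ≤ p)] (hp' : p ≠ ⊤) {ε : ℝ} (hε : 0 < ε) :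
    ∃ K : ℝ, 0 ≤ K ∧ ∀ G H : Lp ℝ p μ, 0 ≤ᵐ[μ] (G : Y → ℝ) → 0 ≤ᵐ[μ] (H : Y → ℝ) →
      ‖G - H‖ ^ p.toReal ≤ ε * ‖G + H‖ ^ p.toReal +
        K * ((‖G‖ ^ p.toReal + ‖H‖ ^ p.toReal) / 2
          - ‖(1 / 2 : ℝ) • G + (1 / 2 : ℝ) • H‖ ^ p.toReal) := by
  have hp0 : p ≠ 0 := (zero_lt_one.trans hp).ne'
  have hP : 1 < p.toReal := by
    simpa using (ENNReal.toReal_lt_toReal ENNReal.one_ne_top hp').2 hp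
  obtain ⟨K, hK, hle⟩ := exists_abs_sub_rpow_le hP hε
  refine ⟨K, hK, fun G H hG hH => ?_⟩
  have hint : ∀ F : Lp ℝ p μ, Integrable (fun x => |F x| ^ p.toReal) μ := fun F => by
    simpa only [Real.norm_eq_abs] using (Lp.memLp F).integrable_norm_rpow hp0 hp'
  simp only [Lp_norm_rpow_eq_integral hp hp']
  have hmean : Integrable (fun x => (|G x| ^ p.toReal + |H x| ^ p.toReal) / 2) μ :=
    ((hint G).add (hint H)).div_const 2
  have hgap : Integrable (fun x => K * ((|G x| ^ p.toReal + |H x| ^ p.toReal) / 2 -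
      |((1 / 2 : ℝ) • G + (1 / 2 : ℝ) • H : Lp ℝ p μ) x| ^ p.toReal)) μ :=
    (hmean.sub (hint _)).const_mul K
  have hsum : Integrable (fun x => ε * |(G + H : Lp ℝ p μ) x| ^ p.toReal) μ :=
    (hint _).const_mul ε
  rw [← integral_add (hint G) (hint H), ← integral_div, ← integral_sub hmean (hint _),
    ← integral_const_mul, ← integral_const_mul, ← integral_add hsum hgap]
  refine integral_mono_ae (hint _) (hsum.add hgap) ?_
  filter_upwards [hG, hH, Lp.coeFn_sub G H, Lp.coeFn_add G H,
    Lp.coeFn_add ((1 / 2 : ℝ) • G) ((1 / 2 : ℝ) • H), Lp.coeFn_smul (1 / 2 : ℝ) G,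
    Lp.coeFn_smul (1 / 2 : ℝ) H] with x hGx hHx h1 h2 h3 h4 h5
  simp only [Pi.zero_apply] at hGx hHx
  have e : (1 / 2 * G x + 1 / 2 * H x : ℝ) = (G x + H x) / 2 := by ring
  simp only [h1, h2, h3, h4, h5, Pi.sub_apply, Pi.add_apply, Pi.smul_apply, smul_eq_mul, e]
  have := hle _ _ hGx hHx
  rwa [abs_of_nonneg (add_nonneg hGx hHx), abs_of_nonneg hGx, abs_of_nonneg hHx,
    abs_of_nonneg (div_nonneg (add_nonneg hGx hHx) zero_le_two)]

/-- A nonempty closed convex set of nonnegative functions in `Lᵖ`, `1 < p < ∞`, contains an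
element of minimal norm. -/
lemma exists_min_norm_of_convex_isClosed_nonneg (hp : 1 < p) [Fact (1 ≤ p)] (hp' : p ≠ ⊤)
    {S : Set (Lp ℝ p μ)} (hconv : Convex ℝ S) (hclosed : IsClosed S) (hne : S.Nonempty)
    (hnonneg : ∀ G ∈ S, 0 ≤ᵐ[μ] (G : Y → ℝ)) : ∃ G ∈ S, ∀ H ∈ S, ‖G‖ ≤ ‖H‖ := by
  have hP : 0 < p.toReal := ENNReal.toReal_pos (zero_lt_one.trans hp).ne' hp'
  set d := sInf (norm '' S) with hd
  have hbdd : BddBelow (norm '' S) := ⟨0, by rintro _ ⟨G, -, rfl⟩; exact norm_nonneg G⟩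
  have hd_le : ∀ G ∈ S, d ≤ ‖G‖ := fun G hG => csInf_le hbdd ⟨G, hG, rfl⟩
  have hd0 : 0 ≤ d := le_csInf (hne.image _) (by rintro _ ⟨G, -, rfl⟩; exact norm_nonneg G)
  obtain ⟨u, -, hu_tendsto, hu_mem⟩ := exists_seq_tendsto_sInf (hne.image norm) hbdd
  choose G hGS hGu using hu_mem
  have hlim : Filter.Tendsto (fun n => ‖G n‖) Filter.atTop (nhds d) := by
    simpa only [hGu] using hu_tendsto
  have hcauchy : CauchySeq G := by
    rw [Metric.cauchySeq_iff]
    intro r hr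
    have hr' : 0 < r ^ p.toReal := Real.rpow_pos_of_pos hr _
    set B := (2 * (d + 1)) ^ p.toReal with hB
    have hBpos : 0 < B := Real.rpow_pos_of_pos (by linarith) _
    obtain ⟨K, hK, hle⟩ := exists_Lp_norm_sub_rpow_le (μ := μ) hp hp'
      (show 0 < r ^ p.toReal / (2 * B) by positivity)
    have hpow : Filter.Tendsto (fun n => K * (‖G n‖ ^ p.toReal - d ^ p.toReal))
        Filter.atTop (nhds 0) := by
      have := ((hlim.rpow_const (Or.inr hP.le)).sub_const (d ^ p.toReal)).const_mul K
      simpa using this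
    obtain ⟨N, hN⟩ := Filter.eventually_atTop.1
      ((hpow.eventually_lt_const (show 0 < r ^ p.toReal / 2 by positivity)).and
        (hlim.eventually_lt_const (show d < d + 1 by linarith)))
    refine ⟨N, fun i hi j hj => ?_⟩
    obtain ⟨hi1, hi2⟩ := hN i hi
    obtain ⟨hj1, hj2⟩ := hN j hj
    have hmid : d ^ p.toReal ≤ ‖(1 / 2 : ℝ) • G i + (1 / 2 : ℝ) • G j‖ ^ p.toReal :=
      Real.rpow_le_rpow hd0 (hd_le _ (hconv (hGS i) (hGS j) (by norm_num) (by norm_num)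
        (by norm_num))) hP.le
    have hsum : ‖G i + G j‖ ^ p.toReal ≤ B :=
      Real.rpow_le_rpow (norm_nonneg _) ((norm_add_le _ _).trans (by linarith)) hP.le
    have h1 := hle (G i) (G j) (hnonneg _ (hGS i)) (hnonneg _ (hGS j))
    have h2 : r ^ p.toReal / (2 * B) * ‖G i + G j‖ ^ p.toReal ≤ r ^ p.toReal / 2 := by
      calc _ ≤ r ^ p.toReal / (2 * B) * B := by gcongr
        _ = _ := by field_simp
    have h3 := mul_le_mul_of_nonneg_left hmid hK
    rw [dist_eq_norm, ← Real.rpow_lt_rpow_iff (norm_nonneg _) hr.le hP]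
    linarith
  obtain ⟨F, hF⟩ := cauchySeq_tendsto_of_complete hcauchy
  refine ⟨F, hclosed.mem_of_tendsto hF (Filter.Eventually.of_forall hGS), fun H hH => ?_⟩
  rw [tendsto_nhds_unique hF.norm hlim]
  exact hd_le H hH

end LpNorm

instance {Z : Type*} [MetricSpace Z] : BorelSpace C(unitInterval, Z) := ⟨rfl⟩

lemma measurable_uncurry_metricSpeed {Z : Type*} [MetricSpace Z]
    [TopologicalSpace.SeparableSpace Z] :
    Measurable fun z : C(unitInterval, Z) × unitInterval => metricSpeed z.1 z.2 := by
  have : SecondCountableTopology Z := UniformSpace.secondCountable_of_separable Z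
  have hbasis : ∀ z : C(unitInterval, Z) × unitInterval, metricSpeed z.1 z.2 =
      ⨅ n : ℕ, ⨆ s ∈ Metric.ball z.2 (1 / ((n : ℝ) + 1)) ∩ {z.2}ᶜ,
        ENNReal.ofReal (dist (z.1 s) (z.1 z.2)) / ENNReal.ofReal (dist s z.2) := by
    intro z
    rw [metricSpeed, (nhdsWithin_hasBasis Metric.nhds_basis_ball_inv_nat_succ
      ({z.2}ᶜ)).limsup_eq_iInf_iSup]
    simp only [iInf_pos]
  simp only [hbasis]
  refine Measurable.iInf fun n => measurable_of_Ioi fun c => IsOpen.measurableSet ?_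
  have hcont : Continuous fun w : (C(unitInterval, Z) × unitInterval) × unitInterval =>
      dist (w.1.1 w.2) (w.1.1 w.1.2) := by fun_prop
  have hU : IsOpen {w : (C(unitInterval, Z) × unitInterval) × unitInterval |
      dist w.2 w.1.2 < 1 / ((n : ℝ) + 1) ∧ w.2 ≠ w.1.2} :=
    IsOpen.and (isOpen_lt (by fun_prop) continuous_const)
      (isOpen_ne_fun (by fun_prop) (by fun_prop))
  have hquot : ContinuousOn (fun w : (C(unitInterval, Z) × unitInterval) × unitInterval =>
      ENNReal.ofReal (dist (w.1.1 w.2) (w.1.1 w.1.2) / dist w.2 w.1.2))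
      {w | dist w.2 w.1.2 < 1 / ((n : ℝ) + 1) ∧ w.2 ≠ w.1.2} :=
    ENNReal.continuous_ofReal.comp_continuousOn (hcont.continuousOn.div (by fun_prop)
      fun w hw => dist_ne_zero.2 hw.2)
  convert isOpenMap_fst _ (hquot.isOpen_inter_preimage hU (isOpen_Ioi (a := c))) using 1
  ext z
  simp only [Set.mem_preimage, Set.mem_Ioi, lt_iSup_iff, Set.mem_image, Set.mem_inter_iff,
    Metric.mem_ball, Set.mem_compl_iff, Set.mem_singleton_iff, Set.mem_ofPred_eq, exists_prop]
  constructor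
  · rintro ⟨s, ⟨h1, h2⟩, h3⟩
    refine ⟨(z, s), ⟨⟨h1, h2⟩, ?_⟩, rfl⟩
    rwa [ENNReal.ofReal_div_of_pos (dist_pos.2 h2)]
  · rintro ⟨⟨z, s⟩, ⟨⟨h1, h2⟩, h3⟩, rfl⟩
    refine ⟨s, ⟨h1, h2⟩, ?_⟩
    rwa [ENNReal.ofReal_div_of_pos (dist_pos.2 h2)] at h3

/-- The right-hand side of the weak upper gradient inequality along a test plan is integration
against a measure on `X` which is bounded on `Lᵖ(m)`. -/
lemma IsTestPlan.exists_measure {m : Measure X} {P q : ℝ} (hPq : P.HolderConjugate q)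
    {π : Measure C(unitInterval, X)} (hπ : IsTestPlan m q π) :
    ∃ N : Measure X,
      (∀ G : X → ℝ, Measurable G →
        ∫⁻ γ, ∫⁻ t, ENNReal.ofReal (G (γ t)) * metricSpeed γ t ∂volume ∂π =
          ∫⁻ x, ENNReal.ofReal (G x) ∂N) ∧
      ∃ A : ℝ≥0∞, A ≠ ⊤ ∧ ∀ g : X → ℝ≥0∞, Measurable g →
        ∫⁻ x, g x ∂N ≤ A * (∫⁻ x, g x ^ P ∂m) ^ (1 / P) := by
  have : SecondCountableTopology X := UniformSpace.secondCountable_of_separable X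
  obtain ⟨hprob, -, ⟨C, -, hC⟩, hE⟩ := hπ
  have hspeed := measurable_uncurry_metricSpeed (Z := X)
  have hev : Measurable fun z : C(unitInterval, X) × unitInterval => z.1 z.2 :=
    Continuous.measurable (by fun_prop)
  let ρ := (π.prod volume).withDensity fun z => metricSpeed z.1 z.2
  have hN : ∀ g : X → ℝ≥0∞, Measurable g → ∫⁻ x, g x ∂(ρ.map fun z => z.1 z.2) =
      ∫⁻ z, g (z.1 z.2) * metricSpeed z.1 z.2 ∂(π.prod volume) := fun g hg => by
    rw [lintegral_map hg hev]
    refine (lintegral_withDensity_eq_lintegral_mul _ hspeed (hg.comp hev)).trans ?_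
    exact lintegral_congr fun z => mul_comm _ _
  refine ⟨ρ.map fun z => z.1 z.2, fun G hG => ?_,
    (C : ℝ≥0∞) ^ (1 / P) * (∫⁻ γ, ∫⁻ t, metricSpeed γ t ^ q ∂volume ∂π) ^ (1 / q), ?_,
    fun g hg => ?_⟩
  · rw [hN _ hG.ennreal_ofReal, lintegral_prod]
    exact ((hG.ennreal_ofReal.comp hev).mul hspeed).aemeasurable
  · exact ENNReal.mul_ne_top
      (ENNReal.rpow_ne_top_of_nonneg (one_div_nonneg.2 hPq.nonneg) ENNReal.coe_ne_top)
      (ENNReal.rpow_ne_top_of_nonneg (one_div_nonneg.2 hPq.symm.nonneg) hE.ne)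
  · have hgP : Measurable fun x => g x ^ P := hg.pow_const P
    have hcompr : ∫⁻ z, g (z.1 z.2) ^ P ∂(π.prod volume) ≤ C * ∫⁻ x, g x ^ P ∂m := by
      refine (lintegral_prod_symm _ (hgP.comp hev).aemeasurable).trans_le ?_
      calc ∫⁻ t, ∫⁻ γ, g (γ t) ^ P ∂π ∂(volume : Measure unitInterval)
          ≤ ∫⁻ _, C * ∫⁻ x, g x ^ P ∂m ∂(volume : Measure unitInterval) := by
            refine lintegral_mono fun t => ?_
            have hevt : Measurable fun γ : C(unitInterval, X) => γ t :=
              Continuous.measurable (by fun_prop)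
            rw [← lintegral_map hgP hevt, ← smul_eq_mul, ← lintegral_smul_measure]
            exact lintegral_mono' (hC t) le_rfl
        _ = _ := by simp
    have hspeed_q : ∫⁻ z, metricSpeed z.1 z.2 ^ q ∂(π.prod volume) =
        ∫⁻ γ, ∫⁻ t, metricSpeed γ t ^ q ∂volume ∂π :=
      lintegral_prod _ (hspeed.pow_const q).aemeasurable
    have hP : 0 ≤ 1 / P := one_div_nonneg.2 hPq.nonneg
    rw [hN g hg]
    calc ∫⁻ z, g (z.1 z.2) * metricSpeed z.1 z.2 ∂(π.prod volume)
        ≤ (∫⁻ z, g (z.1 z.2) ^ P ∂(π.prod volume)) ^ (1 / P) *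
          (∫⁻ z, metricSpeed z.1 z.2 ^ q ∂(π.prod volume)) ^ (1 / q) :=
          ENNReal.lintegral_mul_le_Lp_mul_Lq _ hPq (hg.comp hev).aemeasurable hspeed.aemeasurable
      _ ≤ (C * ∫⁻ x, g x ^ P ∂m) ^ (1 / P) *
          (∫⁻ γ, ∫⁻ t, metricSpeed γ t ^ q ∂volume ∂π) ^ (1 / q) := by
          rw [hspeed_q]
          gcongr
      _ = _ := by rw [ENNReal.mul_rpow_of_nonneg _ _ hP]; ring

section Cone

variable {Y : Type*} [MeasurableSpace Y] {μ N : Measure Y} {p : ℝ≥0∞}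

lemma convex_setOf_nonneg_le_lintegral [Fact (1 ≤ p)] (hN : N ≪ μ) (L : ℝ≥0∞) :
    Convex ℝ {G : Lp ℝ p μ | 0 ≤ᵐ[μ] (G : Y → ℝ) ∧ L ≤ ∫⁻ x, ENNReal.ofReal (G x) ∂N} := by
  rintro G ⟨hG0, hG⟩ H ⟨hH0, hH⟩ a b ha hb hab
  have hadd := Lp.coeFn_add (a • G) (b • H)
  have hsG := Lp.coeFn_smul a G
  have hsH := Lp.coeFn_smul b H
  have hcomb : ∀ᵐ x ∂μ, (a • G + b • H : Lp ℝ p μ) x = a * G x + b * H x := by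
    filter_upwards [hadd, hsG, hsH] with x h1 h2 h3
    rw [h1, Pi.add_apply, h2, h3, Pi.smul_apply, Pi.smul_apply, smul_eq_mul, smul_eq_mul]
  have hGm := (Lp.stronglyMeasurable G).measurable.ennreal_ofReal
  have hHm := (Lp.stronglyMeasurable H).measurable.ennreal_ofReal
  refine ⟨?_, ?_⟩
  · filter_upwards [hcomb, hG0, hH0] with x h1 h2 h3
    rw [h1]
    exact add_nonneg (mul_nonneg ha h2) (mul_nonneg hb h3)
  · calc L = ENNReal.ofReal a * L + ENNReal.ofReal b * L := by
          rw [← add_mul, ← ENNReal.ofReal_add ha hb, hab, ENNReal.ofReal_one, one_mul]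
      _ ≤ ENNReal.ofReal a * ∫⁻ x, ENNReal.ofReal (G x) ∂N +
          ENNReal.ofReal b * ∫⁻ x, ENNReal.ofReal (H x) ∂N := by gcongr
      _ = ∫⁻ x, ENNReal.ofReal ((a • G + b • H : Lp ℝ p μ) x) ∂N := by
          rw [← lintegral_const_mul _ hGm, ← lintegral_const_mul _ hHm,
            ← lintegral_add_left (hGm.const_mul _)]
          refine lintegral_congr_ae ?_
          filter_upwards [hN.ae_le hcomb, hN.ae_le hG0, hN.ae_le hH0] with x h1 h2 h3
          rw [h1, ENNReal.ofReal_add (mul_nonneg ha h2) (mul_nonneg hb h3),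
            ENNReal.ofReal_mul ha, ENNReal.ofReal_mul hb]

lemma isClosed_setOf_nonneg_le_lintegral [Fact (1 ≤ p)] (hp' : p ≠ ⊤) (hN : N ≪ μ)
    {A : ℝ≥0∞} (hA : A ≠ ⊤)
    (hbound : ∀ g : Y → ℝ≥0∞, Measurable g →
      ∫⁻ x, g x ∂N ≤ A * (∫⁻ x, g x ^ p.toReal ∂μ) ^ (1 / p.toReal)) (L : ℝ≥0∞) :
    IsClosed {G : Lp ℝ p μ | 0 ≤ᵐ[μ] (G : Y → ℝ) ∧ L ≤ ∫⁻ x, ENNReal.ofReal (G x) ∂N} := by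
  have hp0 : p ≠ 0 := (zero_lt_one.trans_le (Fact.out : 1 ≤ p)).ne'
  have hclosed : IsClosed {G : Lp ℝ p μ | 0 ≤ᵐ[μ] (G : Y → ℝ)} := by
    simp only [Lp.coeFn_nonneg]
    exact isClosed_Ici
  refine hclosed.inter (IsSeqClosed.isClosed fun G F hG hF => ?_)
  have hdiff : ∀ n, ∫⁻ x, ENNReal.ofReal (G n x) ∂N ≤
      ∫⁻ x, ENNReal.ofReal (F x) ∂N + A * ‖G n - F‖ₑ := by
    intro n
    have hm : Measurable fun x => ‖(G n - F : Lp ℝ p μ) x‖ₑ :=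
      (Lp.stronglyMeasurable (G n - F)).measurable.enorm
    calc ∫⁻ x, ENNReal.ofReal (G n x) ∂N
        ≤ ∫⁻ x, (ENNReal.ofReal (F x) + ‖(G n - F : Lp ℝ p μ) x‖ₑ) ∂N := by
          refine lintegral_mono_ae ?_
          filter_upwards [hN.ae_le (Lp.coeFn_sub (G n) F)] with x hx
          rw [hx, Real.enorm_eq_ofReal_abs, Pi.sub_apply]
          refine (ENNReal.ofReal_le_ofReal ?_).trans ENNReal.ofReal_add_le
          linarith [le_abs_self (G n x - F x)]
      _ = ∫⁻ x, ENNReal.ofReal (F x) ∂N + ∫⁻ x, ‖(G n - F : Lp ℝ p μ) x‖ₑ ∂N :=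
          lintegral_add_right _ hm
      _ ≤ _ := by
          gcongr
          refine (hbound _ hm).trans_eq ?_
          rw [Lp.enorm_def, eLpNorm_eq_lintegral_rpow_enorm_toReal hp0 hp']
  have hlim : Filter.Tendsto (fun n => ∫⁻ x, ENNReal.ofReal (F x) ∂N + A * ‖G n - F‖ₑ)
      Filter.atTop (nhds (∫⁻ x, ENNReal.ofReal (F x) ∂N)) := by
    have h0 : Filter.Tendsto (fun n => ‖G n - F‖ₑ) Filter.atTop (nhds 0) := by
      have := (hF.sub_const F).enorm
      simpa using this
    have := (ENNReal.Tendsto.const_mul h0 (Or.inr hA)).const_add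
      (∫⁻ x, ENNReal.ofReal (F x) ∂N)
    simpa using this
  exact ge_of_tendsto' hlim fun n => le_trans (hG n) (hdiff n)

end Cone

lemma IsTestPlan.convex_isClosed {m : Measure X} {p : ℝ≥0∞} {q : ℝ} [Fact (1 ≤ p)]
    (hp' : p ≠ ⊤) (hpq : p.toReal.HolderConjugate q) {π : Measure C(unitInterval, X)}
    (hπ : IsTestPlan m q π) (L : ℝ≥0∞) :
    Convex ℝ {G : Lp ℝ p m | 0 ≤ᵐ[m] (G : X → ℝ) ∧
      L ≤ ∫⁻ γ, ∫⁻ t, ENNReal.ofReal (G (γ t)) * metricSpeed γ t ∂volume ∂π} ∧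
    IsClosed {G : Lp ℝ p m | 0 ≤ᵐ[m] (G : X → ℝ) ∧
      L ≤ ∫⁻ γ, ∫⁻ t, ENNReal.ofReal (G (γ t)) * metricSpeed γ t ∂volume ∂π} := by
  obtain ⟨N, hN, A, hA, hbound⟩ := hπ.exists_measure hpq
  have hac : N ≪ m := by
    refine Measure.AbsolutelyContinuous.mk fun s hs hs0 => ?_
    have h := hbound (s.indicator 1) (measurable_one.indicator hs)
    have hzero : ∫⁻ x, s.indicator (1 : X → ℝ≥0∞) x ^ p.toReal ∂m = 0 := by
      rw [lintegral_eq_zero_iff ((measurable_one.indicator hs).pow_const _)]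
      filter_upwards [measure_eq_zero_iff_ae_notMem.1 hs0] with x hx
      simp [hx, hpq.pos]
    rw [lintegral_indicator_one hs, hzero, ENNReal.zero_rpow_of_pos (one_div_pos.2 hpq.pos),
      mul_zero] at h
    exact le_antisymm h zero_le
  have hG : ∀ G : Lp ℝ p m, _ := fun G => hN G (Lp.stronglyMeasurable G).measurable
  simp only [hG]
  exact ⟨convex_setOf_nonneg_le_lintegral hac L,
    isClosed_setOf_nonneg_le_lintegral hp' hac hA hbound L⟩

/-- The set of weak upper gradients of `f` in `Lᵖ(m)` is convex and closed; in particular,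
if nonempty it contains an element of minimal `Lᵖ`-norm. -/
theorem gradSet_convex_isClosed_exists_min
    (m : Measure X) [IsFiniteMeasure m] (p : ℝ≥0∞) (q : ℝ)
    (hp : 1 < p) [Fact (1 ≤ p)] (hp' : p ≠ ⊤) (hpq : 1 / p.toReal + 1 / q = 1)
    (f : X → ℝ) (hf : Measurable f) :
    Convex ℝ (gradSet m p q f) ∧ IsClosed (gradSet m p q f) ∧
      ((gradSet m p q f).Nonempty →
        ∃ G ∈ gradSet m p q f, ∀ H ∈ gradSet m p q f, ‖G‖ ≤ ‖H‖) := by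
  have hP : 1 < p.toReal := by
    simpa using (ENNReal.toReal_lt_toReal ENNReal.one_ne_top hp').2 hp
  have hconj : p.toReal.HolderConjugate q :=
    Real.holderConjugate_iff.2 ⟨hP, by simpa only [one_div] using hpq⟩
  have heq : gradSet m p q f = {G : Lp ℝ p m | 0 ≤ᵐ[m] (G : X → ℝ)} ∩
      ⋂ (π : Measure C(unitInterval, X)) (_ : IsTestPlan m q π),
        {G : Lp ℝ p m | 0 ≤ᵐ[m] (G : X → ℝ) ∧
          ∫⁻ γ, ENNReal.ofReal |f (γ 1) - f (γ 0)| ∂π ≤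
            ∫⁻ γ, ∫⁻ t, ENNReal.ofReal (G (γ t)) * metricSpeed γ t ∂volume ∂π} := by
    ext G
    simp only [gradSet, Set.mem_ofPred_eq, Set.mem_inter_iff, Set.mem_iInter]
    exact ⟨fun h => ⟨h.1, fun π hπ => ⟨h.1, h.2 π hπ⟩⟩, fun h => ⟨h.1, fun π hπ => (h.2 π hπ).2⟩⟩
  have hcone : {G : Lp ℝ p m | 0 ≤ᵐ[m] (G : X → ℝ)} = Set.Ici 0 := by
    ext G
    exact Lp.coeFn_nonneg G
  have hconv : Convex ℝ (gradSet m p q f) := by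
    rw [heq, hcone]
    refine Convex.inter ?_ (convex_iInter₂ fun π hπ => (IsTestPlan.convex_isClosed hp' hconj hπ _).1)
    rw [← hcone]
    simpa using convex_setOf_nonneg_le_lintegral (Measure.AbsolutelyContinuous.refl m) (p := p) 0
  have hclosed : IsClosed (gradSet m p q f) := by
    rw [heq, hcone]
    exact isClosed_Ici.inter (isClosed_biInter fun π hπ => (IsTestPlan.convex_isClosed hp' hconj hπ _).2)
  exact ⟨hconv, hclosed, fun hne =>
    exists_min_norm_of_convex_isClosed_nonneg hp hp' hconv hclosed hne fun G hG => hG.1⟩
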